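/- arXiv:2104.05498 — 5 statements merged into one kernel-verified Lean document; each statement's English description precedes it below -/
import Mathlib

section
/- A linear map D : W(2) → W(2) is a derivation of W(2) if and only if there exist scalars α, β ∈ F such that D(e₁) = 2α e₃, D(e₂) = α e₁ − β e₂, D(e₃) = β e₃ + 3α e₄, D(e₄) = 2β e₄, D(e₅) = −α e₆, D(e₆) = β e₆, D(e₇) = β e₇, and D(e₈) = α e₇. -/
set_option maxSynthPendingDepth 3

/-- The 2-dimensional vector space `V₂ = F²`, with standard basis `v₁ = (1,0)`, `v₂ = (0,1)`. -/
abbrev V2 (F : Type*) [Field F] := Fin 2 → F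

/-- The fixed vector `v₁` (the first standard basis vector of `V₂`). -/
noncomputable def v1 (F : Type*) [Field F] : V2 F := Pi.single 0 1

/-- `W(2)`: the space of all bilinear multiplications on `V₂`. -/
abbrev Wtwo (F : Type*) [Field F] := V2 F →ₗ[F] V2 F →ₗ[F] V2 F

variable {F : Type*} [Field F]

/-- The Kantor product on `W(2)`:
`(A·B)(x,y) = A(v₁, B(x,y)) − B(A(v₁,x), y) − B(x, A(v₁,y))`. -/
noncomputable def wmul (A B : Wtwo F) : Wtwo F :=
  LinearMap.mk₂ F
    (fun x y => A (v1 F) (B x y) - B (A (v1 F) x) y - B x (A (v1 F) y))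
    (fun x x' y => by simp only [map_add, LinearMap.add_apply]; abel)
    (fun c x y => by simp only [map_smul, LinearMap.smul_apply, smul_sub])
    (fun x y y' => by simp only [map_add, LinearMap.add_apply]; abel)
    (fun c x y => by simp only [map_smul, LinearMap.smul_apply, smul_sub])

/-- The multiplication `α^k_{i,j}` determined by `α^k_{i,j}(v_t, v_l) = δ_{it} δ_{jl} v_k`
(indices `0, 1` correspond to `1, 2` in the paper). -/
noncomputable def alph (k i j : Fin 2) : Wtwo F :=
  LinearMap.mk₂ F
    (fun x y => (x i * y j) • (Pi.single k 1 : V2 F))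
    (fun x x' y => by simp [add_mul, add_smul])
    (fun c x y => by simp [smul_smul, mul_assoc])
    (fun x y y' => by simp [mul_add, add_smul])
    (fun c x y => by simp [smul_smul]; ring_nf)

noncomputable def e1 (F : Type*) [Field F] : Wtwo F := alph 0 0 0 - alph 1 0 1 - alph 1 1 0

noncomputable def e2 (F : Type*) [Field F] : Wtwo F := alph 1 0 0

noncomputable def e3 (F : Type*) [Field F] : Wtwo F := alph 1 1 1 - alph 0 0 1 - alph 0 1 0

noncomputable def e4 (F : Type*) [Field F] : Wtwo F := alph 0 1 1

noncomputable def e5 (F : Type*) [Field F] : Wtwo F := (2 : F) • alph 0 0 0 + alph 1 0 1 + alph 1 1 0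

noncomputable def e6 (F : Type*) [Field F] : Wtwo F := (2 : F) • alph 1 1 1 + alph 0 0 1 + alph 0 1 0

noncomputable def e7 (F : Type*) [Field F] : Wtwo F := alph 0 0 1 - alph 0 1 0

noncomputable def e8 (F : Type*) [Field F] : Wtwo F := alph 1 0 1 - alph 1 1 0


/-- A derivation of `W(2)`: a linear map satisfying the Leibniz rule. -/
def IsDerivation (D : Wtwo F →ₗ[F] Wtwo F) : Prop :=
  ∀ x y : Wtwo F, D (wmul x y) = wmul (D x) y + wmul x (D y)

/-- The basis `e₁, …, e₈` of `W(2)`, indexed by `Fin 8`. -/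
noncomputable def eFamily (F : Type*) [Field F] : Fin 8 → Wtwo F :=
  ![e1 F, e2 F, e3 F, e4 F, e5 F, e6 F, e7 F, e8 F]

/-- The multiplication with coordinates `a` in the basis `e₁, …, e₈`. -/
noncomputable def ofCoords (F : Type*) [Field F] : (Fin 8 → F) →ₗ[F] Wtwo F :=
  Fintype.linearCombination F (eFamily F)

lemma ofCoords_apply (a : Fin 8 → F) (x y : V2 F) :
    ofCoords F a x y =
      ![(a 0 + 2 * a 4) * (x 0 * y 0) + (-a 2 + a 5 + a 6) * (x 0 * y 1) +
          (-a 2 + a 5 - a 6) * (x 1 * y 0) + a 3 * (x 1 * y 1),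
        a 1 * (x 0 * y 0) + (-a 0 + a 4 + a 7) * (x 0 * y 1) +
          (-a 0 + a 4 - a 7) * (x 1 * y 0) + (a 2 + 2 * a 5) * (x 1 * y 1)] := by
  ext k
  fin_cases k <;>
    simp [ofCoords, eFamily, Fintype.linearCombination_apply, Fin.sum_univ_eight,
      e1, e2, e3, e4, e5, e6, e7, e8, alph] <;> ring

lemma ofCoords_injective [CharZero F] : Function.Injective (ofCoords F) := by
  intro a b h
  have key (i j k : Fin 2) :
      ofCoords F a (Pi.single i 1) (Pi.single j 1) k =
        ofCoords F b (Pi.single i 1) (Pi.single j 1) k := by rw [h]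
  simp only [ofCoords_apply, Fin.forall_fin_two] at key
  simp at key
  ext k
  fin_cases k <;> grind

lemma ofCoords_surjective [CharZero F] : Function.Surjective (ofCoords F) := by
  intro A
  let s (i j k : Fin 2) : F := A (Pi.single i 1) (Pi.single j 1) k
  refine ⟨![(s 0 0 0 - s 0 1 1 - s 1 0 1) / 3, s 0 0 1, (s 1 1 1 - s 0 1 0 - s 1 0 0) / 3,
    s 1 1 0, (2 * s 0 0 0 + s 0 1 1 + s 1 0 1) / 6, (2 * s 1 1 1 + s 0 1 0 + s 1 0 0) / 6,
    (s 0 1 0 - s 1 0 0) / 2, (s 0 1 1 - s 1 0 1) / 2], ?_⟩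
  ext i j k
  fin_cases i <;> fin_cases j <;> fin_cases k <;>
    simp [ofCoords_apply, s] <;> ring

/-- The Kantor product in the coordinates of `e₁, …, e₈`. -/
def coordMul (a b : Fin 8 → F) : Fin 8 → F :=
  ![-a 0 * b 0 - 2 * a 4 * b 0 - a 2 * b 1 + a 5 * b 1 + a 6 * b 1 + 2 * a 1 * b 2,
    3 * a 1 * b 0 - 3 * a 0 * b 1 - 3 * a 4 * b 1 + a 7 * b 1,
    -2 * a 2 * b 0 + 2 * a 5 * b 0 + 2 * a 6 * b 0 + a 0 * b 2 - a 4 * b 2 - a 7 * b 2 + a 1 * b 3,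
    -3 * a 2 * b 2 + 3 * a 5 * b 2 + 3 * a 6 * b 2 + 3 * a 0 * b 3 - 2 * a 7 * b 3,
    -a 0 * b 4 - 2 * a 4 * b 4 - a 1 * b 5,
    a 2 * b 4 - a 5 * b 4 - a 6 * b 4 + a 0 * b 5 - a 4 * b 5 - a 7 * b 5,
    a 0 * b 6 - a 4 * b 6 - a 7 * b 6 - a 2 * b 7 + a 5 * b 7 + a 6 * b 7,
    a 1 * b 6 - a 0 * b 7 - 2 * a 4 * b 7]

lemma wmul_ofCoords (a b : Fin 8 → F) :
    wmul (ofCoords F a) (ofCoords F b) = ofCoords F (coordMul a b) := by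
  ext i j k
  fin_cases i <;> fin_cases j <;> fin_cases k <;>
    simp [wmul, v1, ofCoords_apply, coordMul] <;> ring

lemma isDerivation_iff_coordMul [CharZero F] {D : Wtwo F →ₗ[F] Wtwo F}
    {d : (Fin 8 → F) → (Fin 8 → F)} (hd : ∀ a, D (ofCoords F a) = ofCoords F (d a)) :
    IsDerivation D ↔
      ∀ a b, d (coordMul a b) = coordMul (d a) b + coordMul a (d b) := by
  simp only [IsDerivation, ofCoords_surjective.forall, wmul_ofCoords, hd, ← map_add,
    ofCoords_injective.eq_iff]

lemma map_ofCoords {D : Wtwo F →ₗ[F] Wtwo F} {M : Matrix (Fin 8) (Fin 8) F}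
    (hM : ∀ i, D (eFamily F i) = ofCoords F (M i)) (a : Fin 8 → F) :
    D (ofCoords F a) = ofCoords F (Matrix.vecMul a M) := by
  have hsum : Matrix.vecMul a M = ∑ i, a i • M i := by
    ext k
    simp [Matrix.vecMul, dotProduct]
  rw [hsum, ofCoords, Fintype.linearCombination_apply]
  simp only [map_sum, map_smul, hM, ofCoords]

/-- The coordinate matrix of the derivation with parameters `α` and `β`; row `i` holds the
coordinates of the image of the `i`-th basis vector. -/
def derivationMatrix (α β : F) : Matrix (Fin 8) (Fin 8) F :=
  ![![0, 0, 2 * α, 0, 0, 0, 0, 0],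
    ![α, -β, 0, 0, 0, 0, 0, 0],
    ![0, 0, β, 3 * α, 0, 0, 0, 0],
    ![0, 0, 0, 2 * β, 0, 0, 0, 0],
    ![0, 0, 0, 0, 0, -α, 0, 0],
    ![0, 0, 0, 0, 0, β, 0, 0],
    ![0, 0, 0, 0, 0, 0, β, 0],
    ![0, 0, 0, 0, 0, 0, α, 0]]

lemma map_eFamily_iff {D : Wtwo F →ₗ[F] Wtwo F} {α β : F} :
    (∀ i, D (eFamily F i) = ofCoords F (derivationMatrix α β i)) ↔
      D (e1 F) = (2 * α) • e3 F ∧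
      D (e2 F) = α • e1 F - β • e2 F ∧
      D (e3 F) = β • e3 F + (3 * α) • e4 F ∧
      D (e4 F) = (2 * β) • e4 F ∧
      D (e5 F) = (-α) • e6 F ∧
      D (e6 F) = β • e6 F ∧
      D (e7 F) = β • e7 F ∧
      D (e8 F) = α • e7 F := by
  simp [Fin.forall_fin_succ, eFamily, ofCoords, Fintype.linearCombination_apply,
    Fin.sum_univ_eight, derivationMatrix, sub_eq_add_neg]

lemma vecMul_derivationMatrix (α β : F) (a : Fin 8 → F) :
    Matrix.vecMul a (derivationMatrix α β) =
      ![α * a 1, -β * a 1, 2 * α * a 0 + β * a 2, 3 * α * a 2 + 2 * β * a 3, 0,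
        -α * a 4 + β * a 5, β * a 6 + α * a 7, 0] := by
  ext k
  fin_cases k <;>
    simp [derivationMatrix, Matrix.vecMul, dotProduct, Fin.sum_univ_eight] <;> ring

lemma vecMul_derivationMatrix_coordMul (α β : F) (a b : Fin 8 → F) :
    Matrix.vecMul (coordMul a b) (derivationMatrix α β) =
      coordMul (Matrix.vecMul a (derivationMatrix α β)) b +
        coordMul a (Matrix.vecMul b (derivationMatrix α β)) := by
  ext k
  fin_cases k <;> simp [vecMul_derivationMatrix, coordMul] <;> ring

set_option maxHeartbeats 2000000 in
lemma eq_derivationMatrix_of_leibniz [CharZero F] {M : Matrix (Fin 8) (Fin 8) F}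
    (h : ∀ a b, Matrix.vecMul (coordMul a b) M =
      coordMul (Matrix.vecMul a M) b + coordMul a (Matrix.vecMul b M)) :
    M = derivationMatrix (M 7 6) (M 6 6) := by
  have key (i j : Fin 8) := funext_iff.1 (h (Pi.single i 1) (Pi.single j 1))
  have h01 := key 0 1
  have h03 := key 0 3
  have h12 := key 1 2
  have h15 := key 1 5
  have h16 := key 1 6
  have h24 := key 2 4
  have h57 := key 5 7
  have h13 := key 1 3
  have h40 := key 4 0
  have h60 := key 6 0
  have h70 := key 7 0
  simp [Fin.forall_fin_succ, coordMul, Matrix.vecMul, dotProduct, Fin.sum_univ_eight]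
    at h01 h03 h12 h15 h16 h24 h57 h13 h40 h60 h70
  ext i j
  fin_cases i <;> fin_cases j <;> simp [derivationMatrix] <;> grind

/-- A linear map `D : W(2) → W(2)` is a derivation if and only if there exist scalars
`α, β ∈ F` with `D e₁ = 2α e₃`, `D e₂ = α e₁ − β e₂`, `D e₃ = β e₃ + 3α e₄`,
`D e₄ = 2β e₄`, `D e₅ = −α e₆`, `D e₆ = β e₆`, `D e₇ = β e₇`, `D e₈ = α e₇`. -/
theorem isDerivation_iff {F : Type*} [Field F] [CharZero F] (D : Wtwo F →ₗ[F] Wtwo F) :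
    IsDerivation D ↔ ∃ α β : F,
      D (e1 F) = (2 * α) • e3 F ∧
      D (e2 F) = α • e1 F - β • e2 F ∧
      D (e3 F) = β • e3 F + (3 * α) • e4 F ∧
      D (e4 F) = (2 * β) • e4 F ∧
      D (e5 F) = (-α) • e6 F ∧
      D (e6 F) = β • e6 F ∧
      D (e7 F) = β • e7 F ∧
      D (e8 F) = α • e7 F := by
  constructor
  · intro hD
    choose M hM using fun i => ofCoords_surjective (D (eFamily F i))
    have hMd := eq_derivationMatrix_of_leibniz
      ((isDerivation_iff_coordMul (map_ofCoords fun i => (hM i).symm)).1 hD)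
    exact ⟨M 7 6, M 6 6, map_eFamily_iff.1 fun i => by rw [← hM, ← hMd]⟩
  · rintro ⟨α, β, h⟩
    exact (isDerivation_iff_coordMul (map_ofCoords (map_eFamily_iff.2 h))).2
      (vecMul_derivationMatrix_coordMul α β)
end

section
/- A linear map φ : W(2) → W(2) is an automorphism of W(2) if and only if there exist scalars a, b ∈ F with b ≠ 0 such that φ(e₁) = e₁ + 2ab e₃ + 3a²b² e₄, φ(e₂) = a e₁ + b⁻¹ e₂ + a²b e₃ + a³b² e₄, φ(e₃) = b e₃ + 3ab² e₄, φ(e₄) = b² e₄, φ(e₅) = e₅ − ab e₆, φ(e₆) = b e₆, φ(e₇) = b e₇, and φ(e₈) = ab e₇ + e₈. -/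
set_option maxSynthPendingDepth 3

variable {F : Type*} [Field F]

/-- An automorphism of `W(2)`: a bijective linear map that is multiplicative. -/
def IsAutomorphism (φ : Wtwo F →ₗ[F] Wtwo F) : Prop :=
  Function.Bijective φ ∧ ∀ x y : Wtwo F, φ (wmul x y) = wmul (φ x) (φ y)

/-- The multiplication of `W(2)` in coordinates with respect to `e₁, …, e₈`. -/
def kantorTable {F : Type*} [Field F] (x y : Fin 8 → F) : Fin 8 → F :=
  ![-(x 0 * y 0) + 2 * (x 1 * y 2) - x 2 * y 1 - 2 * (x 4 * y 0) + x 5 * y 1 + x 6 * y 1,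
    -(3 * (x 0 * y 1)) + 3 * (x 1 * y 0) - 3 * (x 4 * y 1) + x 7 * y 1,
    x 0 * y 2 + x 1 * y 3 - 2 * (x 2 * y 0) - x 4 * y 2 + 2 * (x 5 * y 0) + 2 * (x 6 * y 0)
      - x 7 * y 2,
    3 * (x 0 * y 3) - 3 * (x 2 * y 2) + 3 * (x 5 * y 2) + 3 * (x 6 * y 2) - 2 * (x 7 * y 3),
    -(x 0 * y 4) - x 1 * y 5 - 2 * (x 4 * y 4),
    x 0 * y 5 + x 2 * y 4 - x 4 * y 5 - x 5 * y 4 - x 6 * y 4 - x 7 * y 5,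
    x 0 * y 6 - x 2 * y 7 - x 4 * y 6 + x 5 * y 7 + x 6 * y 7 - x 7 * y 6,
    -(x 0 * y 7) + x 1 * y 6 - 2 * (x 4 * y 7)]

/-- The coordinates of a multiplication with respect to `e₁, …, e₈`. -/
noncomputable def kantorCoords {F : Type*} [Field F] (A : Wtwo F) : Fin 8 → F :=
  let c (k i j : Fin 2) : F := A (Pi.single i 1) (Pi.single j 1) k
  ![(c 0 0 0 - c 1 0 1 - c 1 1 0) / 3, c 1 0 0, (c 1 1 1 - c 0 0 1 - c 0 1 0) / 3, c 0 1 1,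
    (2 * c 0 0 0 + c 1 0 1 + c 1 1 0) / 6, (2 * c 1 1 1 + c 0 0 1 + c 0 1 0) / 6,
    (c 0 0 1 - c 0 1 0) / 2, (c 1 0 1 - c 1 1 0) / 2]

/-- The multiplication with given coordinates with respect to `e₁, …, e₈`. -/
noncomputable def kantorComb {F : Type*} [Field F] (x : Fin 8 → F) : Wtwo F :=
  x 0 • e1 F + x 1 • e2 F + x 2 • e3 F + x 3 • e4 F + x 4 • e5 F + x 5 • e6 F + x 6 • e7 F
    + x 7 • e8 F

theorem kantorComb_apply {F : Type*} [Field F] (x : Fin 8 → F) (u v : V2 F) :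
    kantorComb x u v =
      ![(x 0 + 2 * x 4) * (u 0 * v 0) + (x 5 - x 2 + x 6) * (u 0 * v 1)
          + (x 5 - x 2 - x 6) * (u 1 * v 0) + x 3 * (u 1 * v 1),
        x 1 * (u 0 * v 0) + (x 4 - x 0 + x 7) * (u 0 * v 1)
          + (x 4 - x 0 - x 7) * (u 1 * v 0) + (x 2 + 2 * x 5) * (u 1 * v 1)] := by
  have h (k i j : Fin 2) : alph k i j u v = (u i * v j) • (Pi.single k 1 : V2 F) := rfl
  ext k
  fin_cases k <;>
    simp [kantorComb, e1, e2, e3, e4, e5, e6, e7, e8, h] <;> ring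

/-- The coordinate isomorphism given by the basis `e₁, …, e₈`. -/
noncomputable def kantorEquiv (F : Type*) [Field F] [CharZero F] : (Fin 8 → F) ≃ₗ[F] Wtwo F where
  toFun := kantorComb
  invFun := kantorCoords
  map_add' x y := by simp only [kantorComb, Pi.add_apply]; module
  map_smul' c x := by simp only [kantorComb, Pi.smul_apply, RingHom.id_apply, smul_eq_mul]; module
  left_inv x := by
    ext k
    fin_cases k <;> simp [kantorCoords, kantorComb_apply] <;> ring
  right_inv A := by
    ext i j k
    fin_cases i <;> fin_cases j <;> fin_cases k <;>
      simp [kantorCoords, kantorComb_apply] <;> ring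

theorem wmul_kantorComb {F : Type*} [Field F] (x y : Fin 8 → F) :
    wmul (kantorComb x) (kantorComb y) = kantorComb (kantorTable x y) := by
  have h (A B : Wtwo F) (u v : V2 F) :
      wmul A B u v = A (v1 F) (B u v) - B (A (v1 F) u) v - B u (A (v1 F) v) := rfl
  ext i j k
  fin_cases i <;> fin_cases j <;> fin_cases k <;>
    simp [h, kantorComb_apply, kantorTable, v1] <;> ring

theorem kantorTable_eq_zero_iff {F : Type*} [Field F] [CharZero F] (k : Fin 8 → F) :
    (∀ y, kantorTable k y = 0) ↔
      k 0 + 2 * k 4 = 0 ∧ k 1 = 0 ∧ k 5 + k 6 = k 2 ∧ k 4 + k 7 = k 0 := by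
  refine ⟨fun h => ?_, fun ⟨h0, h1, h2, h3⟩ y => ?_⟩
  · have h00 := congrFun (h (Pi.single 0 1)) 0
    have h01 := congrFun (h (Pi.single 0 1)) 1
    have h10 := congrFun (h (Pi.single 1 1)) 0
    have h11 := congrFun (h (Pi.single 1 1)) 1
    simp [kantorTable] at h00 h01 h10 h11
    grind
  · ext i
    fin_cases i <;> simp [kantorTable] <;> grind

theorem apply_one_eq_zero_iff {F : Type*} [Field F] [CharZero F] (x : Fin 8 → F) :
    x 1 = 0 ↔ ∀ k, (∀ y, kantorTable k y = 0) → ∀ y, kantorTable (kantorTable x k) y = 0 := by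
  simp only [kantorTable_eq_zero_iff]
  refine ⟨fun h k ⟨h0, h1, h2, h3⟩ => ?_, fun h => ?_⟩
  · simp only [kantorTable, Matrix.cons_val]
    grind
  · have h3 := h (Pi.single 3 1) (by simp)
    simpa [kantorTable] using h3.2.2.1.symm

theorem map_apply_one_eq_zero {F : Type*} [Field F] [CharZero F]
    {ψ : (Fin 8 → F) →ₗ[F] (Fin 8 → F)} (hψ : Function.Bijective ψ)
    (hmul : ∀ x y, ψ (kantorTable x y) = kantorTable (ψ x) (ψ y)) {x : Fin 8 → F} :
    ψ x 1 = 0 ↔ x 1 = 0 := by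
  have hK (k : Fin 8 → F) : (∀ y, kantorTable (ψ k) y = 0) ↔ ∀ y, kantorTable k y = 0 := by
    rw [hψ.surjective.forall]
    exact forall_congr' fun y => by rw [← hmul, map_eq_zero_iff ψ hψ.injective]
  rw [apply_one_eq_zero_iff, apply_one_eq_zero_iff, hψ.surjective.forall]
  refine forall_congr' fun k => ?_
  rw [hK, ← hmul, hK]

/-- The automorphism of `W(2)` with parameters `a` and `b`, in coordinates. -/
def kantorAut {F : Type*} [Field F] (a b : F) (x : Fin 8 → F) : Fin 8 → F :=
  ![x 0 + a * x 1, b⁻¹ * x 1, 2 * a * b * x 0 + a ^ 2 * b * x 1 + b * x 2,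
    3 * a ^ 2 * b ^ 2 * x 0 + a ^ 3 * b ^ 2 * x 1 + 3 * a * b ^ 2 * x 2 + b ^ 2 * x 3,
    x 4, b * x 5 - a * b * x 4, b * x 6 + a * b * x 7, x 7]

theorem kantorAut_kantorTable {F : Type*} [Field F] {a b : F} (hb : b ≠ 0) (x y : Fin 8 → F) :
    kantorAut a b (kantorTable x y) = kantorTable (kantorAut a b x) (kantorAut a b y) := by
  ext i
  fin_cases i <;> simp [kantorAut, kantorTable] <;> field_simp <;> ring

theorem kantorAut_injective {F : Type*} [Field F] {a b : F} (hb : b ≠ 0) :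
    Function.Injective (kantorAut a b) := by
  intro x y h
  simp [kantorAut] at h
  ext i
  fin_cases i <;> simp <;> grind

set_option maxHeartbeats 1000000 in
/-- Here `f i` is the image of the `i`-th basis vector under an endomorphism that preserves the
vanishing of the coordinate along `e₂`. -/
theorem sum_mul_eq_kantorAut {F : Type*} [Field F] [CharZero F] {f : Fin 8 → Fin 8 → F}
    (H : ∀ i j k, kantorTable (f i) (f j) k =
      ∑ l, kantorTable (Pi.single i 1) (Pi.single j 1) l * f l k)
    (f11 : f 1 1 ≠ 0) (hf1 : ∀ i, i ≠ 1 → f i 1 = 0) (x : Fin 8 → F) (k : Fin 8) :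
    ∑ l, x l * f l k = kantorAut (f 1 0) (f 1 1)⁻¹ x k := by
  have f01 := hf1 0 (by decide)
  have f21 := hf1 2 (by decide)
  have f31 := hf1 3 (by decide)
  have f41 := hf1 4 (by decide)
  have f51 := hf1 5 (by decide)
  have f61 := hf1 6 (by decide)
  have f71 := hf1 7 (by decide)
  have f00 : f 0 0 = 1 := by
    have h101 := H 1 0 1
    simp [kantorTable, Fin.sum_univ_eight, *] at h101
    grind
  obtain ⟨f04, f07⟩ : f 0 4 = 0 ∧ f 0 7 = 0 := by
    have h000 := H 0 0 0
    have h011 := H 0 1 1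
    simp [kantorTable, Fin.sum_univ_eight, *] at h000 h011
    grind
  obtain ⟨f14, f15, f16, f17⟩ : f 1 4 = 0 ∧ f 1 5 = 0 ∧ f 1 6 = 0 ∧ f 1 7 = 0 := by
    have h014 := H 0 1 4
    have h015 := H 0 1 5
    have h016 := H 0 1 6
    have h017 := H 0 1 7
    simp [kantorTable, Fin.sum_univ_eight, *] at h014 h015 h016 h017
    grind
  have f12 : f 1 1 * f 1 2 = f 1 0 ^ 2 := by
    have h110 := H 1 1 0
    simp [kantorTable, Fin.sum_univ_eight, *] at h110
    grind
  have f13 : f 1 1 * f 1 3 = f 1 0 * f 1 2 := by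
    have h112 := H 1 1 2
    simp [kantorTable, Fin.sum_univ_eight, *] at h112
    grind
  obtain ⟨f20, f22⟩ : f 2 0 = 0 ∧ f 1 1 * f 2 2 = 1 := by
    have h121 := H 1 2 1
    have h120 := H 1 2 0
    simp [kantorTable, Fin.sum_univ_eight, *] at h121 h120
    grind
  obtain ⟨f30, f32, f33, f34, f35, f36, f37⟩ :
      f 3 0 = 0 ∧ f 3 2 = 0 ∧ f 1 1 * f 3 3 = f 2 2 ∧ f 3 4 = 0 ∧ f 3 5 = 0 ∧ f 3 6 = 0 ∧
      f 3 7 = 0 := by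
    have h131 := H 1 3 1
    have h130 := H 1 3 0
    have h132 := H 1 3 2
    have h034 := H 0 3 4
    have h035 := H 0 3 5
    have h036 := H 0 3 6
    have h037 := H 0 3 7
    simp [kantorTable, Fin.sum_univ_eight, *] at h131 h130 h132 h034 h035 h036 h037
    grind
  obtain ⟨f23, f24, f25, f26, f27⟩ :
      f 2 3 = 3 * f 1 0 * f 3 3 ∧ f 2 4 = 0 ∧ f 2 5 = 0 ∧ f 2 6 = 0 ∧ f 2 7 = 0 := by
    have h133 := H 1 3 3
    have h134 := H 1 3 4
    have h135 := H 1 3 5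
    have h136 := H 1 3 6
    have h137 := H 1 3 7
    simp [kantorTable, Fin.sum_univ_eight, *] at h133 h134 h135 h136 h137
    grind
  obtain ⟨f02, f03, f05, f06⟩ :
      f 0 2 = 2 * f 1 0 * f 2 2 ∧ f 0 3 = 3 * f 1 0 ^ 2 * f 3 3 ∧ f 0 5 = 0 ∧ f 0 6 = 0 := by
    have h122 := H 1 2 2
    have h123 := H 1 2 3
    have h125 := H 1 2 5
    have h126 := H 1 2 6
    simp [kantorTable, Fin.sum_univ_eight, *] at h122 h123 h125 h126
    grind
  obtain ⟨f40, f42, f43⟩ : f 4 0 = 0 ∧ f 4 2 = 0 ∧ f 4 3 = 0 := by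
    have h141 := H 1 4 1
    have h140 := H 1 4 0
    have h142 := H 1 4 2
    simp [kantorTable, Fin.sum_univ_eight, *] at h141 h140 h142
    grind
  obtain ⟨f70, f72, f73⟩ : f 7 0 = 0 ∧ f 7 2 = 0 ∧ f 7 3 = 0 := by
    have h171 := H 1 7 1
    have h170 := H 1 7 0
    have h172 := H 1 7 2
    simp [kantorTable, Fin.sum_univ_eight, *] at h171 h170 h172
    grind
  obtain ⟨f50, f52, f53⟩ : f 5 0 = 0 ∧ f 5 2 = 0 ∧ f 5 3 = 0 := by
    have h151 := H 1 5 1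
    have h150 := H 1 5 0
    have h152 := H 1 5 2
    simp [kantorTable, Fin.sum_univ_eight, *] at h151 h150 h152
    grind
  obtain ⟨f60, f62, f63⟩ : f 6 0 = 0 ∧ f 6 2 = 0 ∧ f 6 3 = 0 := by
    have h161 := H 1 6 1
    have h160 := H 1 6 0
    have h162 := H 1 6 2
    simp [kantorTable, Fin.sum_univ_eight, *] at h161 h160 h162
    grind
  obtain ⟨f47, f44⟩ : f 4 7 = 0 ∧ f 4 4 = 1 := by
    have h433 := H 4 3 3
    have h411 := H 4 1 1
    simp [kantorTable, Fin.sum_univ_eight, *] at h433 h411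
    grind
  obtain ⟨f45, f46⟩ : f 4 5 = -(f 1 0 * f 2 2) ∧ f 4 6 = 0 := by
    have h144 := H 1 4 4
    have h147 := H 1 4 7
    simp [kantorTable, Fin.sum_univ_eight, *] at h144 h147
    grind
  obtain ⟨f57, f54⟩ : f 5 7 = 0 ∧ f 5 4 = 0 := by
    have h533 := H 5 3 3
    have h511 := H 5 1 1
    simp [kantorTable, Fin.sum_univ_eight, *] at h533 h511
    grind
  obtain ⟨f55, f56⟩ : f 5 5 = f 2 2 ∧ f 5 6 = 0 := by
    have h154 := H 1 5 4
    have h157 := H 1 5 7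
    simp [kantorTable, Fin.sum_univ_eight, *] at h154 h157
    grind
  obtain ⟨f77, f74⟩ : f 7 7 = 1 ∧ f 7 4 = 0 := by
    have h733 := H 7 3 3
    have h711 := H 7 1 1
    simp [kantorTable, Fin.sum_univ_eight, *] at h733 h711
    grind
  obtain ⟨f67, f64⟩ : f 6 7 = 0 ∧ f 6 4 = 0 := by
    have h633 := H 6 3 3
    have h611 := H 6 1 1
    simp [kantorTable, Fin.sum_univ_eight, *] at h633 h611
    grind
  obtain ⟨f65, f66⟩ : f 6 5 = 0 ∧ f 6 6 = f 2 2 := by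
    have h164 := H 1 6 4
    have h610 := H 6 1 0
    simp [kantorTable, Fin.sum_univ_eight, *] at h164 h610
    grind
  obtain ⟨f75, f76⟩ : f 7 5 = 0 ∧ f 7 6 = f 1 0 * f 2 2 := by
    have h165 := H 1 6 5
    have h166 := H 1 6 6
    simp [kantorTable, Fin.sum_univ_eight, *] at h165 h166
    grind
  rw [Fin.sum_univ_eight]
  have hb : (f 1 1)⁻¹ = f 2 2 := inv_eq_of_mul_eq_one_right f22
  fin_cases k <;> simp [kantorAut, *] <;> grind

theorem exists_eq_kantorAut {F : Type*} [Field F] [CharZero F]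
    {ψ : (Fin 8 → F) →ₗ[F] (Fin 8 → F)} (hψ : Function.Bijective ψ)
    (hmul : ∀ x y, ψ (kantorTable x y) = kantorTable (ψ x) (ψ y)) :
    ∃ a b : F, b ≠ 0 ∧ ∀ x, ψ x = kantorAut a b x := by
  have hsum (x : Fin 8 → F) (k : Fin 8) : ψ x k = ∑ l, x l * ψ (Pi.single l 1) k := by
    conv_lhs => rw [pi_eq_sum_univ' x]
    simp
  have h1 : ψ (Pi.single 1 1) 1 ≠ 0 := by
    simp [map_apply_one_eq_zero hψ hmul]
  refine ⟨ψ (Pi.single 1 1) 0, _, inv_ne_zero h1, fun x => funext fun k => (hsum x k).trans ?_⟩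
  refine sum_mul_eq_kantorAut (f := fun i => ψ (Pi.single i 1)) (fun i j k => ?_) h1
    (fun i hi => ?_) x k
  · rw [← hsum, hmul]
  · simp [map_apply_one_eq_zero hψ hmul, hi.symm]

theorem map_kantorComb_eq_iff {F : Type*} [Field F] [CharZero F] (φ : Wtwo F →ₗ[F] Wtwo F)
    (a b : F) :
    (∀ x, φ (kantorComb x) = kantorComb (kantorAut a b x)) ↔
      φ (e1 F) = e1 F + (2 * a * b) • e3 F + (3 * a ^ 2 * b ^ 2) • e4 F ∧
      φ (e2 F) = a • e1 F + b⁻¹ • e2 F + (a ^ 2 * b) • e3 F + (a ^ 3 * b ^ 2) • e4 F ∧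
      φ (e3 F) = b • e3 F + (3 * a * b ^ 2) • e4 F ∧
      φ (e4 F) = (b ^ 2) • e4 F ∧
      φ (e5 F) = e5 F - (a * b) • e6 F ∧
      φ (e6 F) = b • e6 F ∧
      φ (e7 F) = b • e7 F ∧
      φ (e8 F) = (a * b) • e7 F + e8 F := by
  constructor
  · intro h
    have h' (i : Fin 8) := h (Pi.single i 1)
    simp only [kantorComb, kantorAut, Matrix.cons_val] at h'
    refine ⟨?_, ?_, ?_, ?_, ?_, ?_, ?_, ?_⟩
    · simpa using h' 0
    · simpa using h' 1
    · simpa using h' 2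
    · simpa using h' 3
    · simpa [sub_eq_add_neg] using h' 4
    · simpa using h' 5
    · simpa using h' 6
    · simpa using h' 7
  · rintro ⟨h1, h2, h3, h4, h5, h6, h7, h8⟩ x
    simp only [kantorComb, kantorAut, map_add, map_smul, h1, h2, h3, h4, h5, h6, h7, h8,
      Matrix.cons_val]
    module

/-- A linear map `φ : W(2) → W(2)` is an automorphism if and only if there exist scalars
`a, b ∈ F`, `b ≠ 0`, acting on the basis `e₁, …, e₈` as in the paper. -/
theorem isAutomorphism_iff {F : Type*} [Field F] [CharZero F] (φ : Wtwo F →ₗ[F] Wtwo F) :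
    IsAutomorphism φ ↔ ∃ a b : F, b ≠ 0 ∧
      φ (e1 F) = e1 F + (2 * a * b) • e3 F + (3 * a ^ 2 * b ^ 2) • e4 F ∧
      φ (e2 F) = a • e1 F + b⁻¹ • e2 F + (a ^ 2 * b) • e3 F + (a ^ 3 * b ^ 2) • e4 F ∧
      φ (e3 F) = b • e3 F + (3 * a * b ^ 2) • e4 F ∧
      φ (e4 F) = (b ^ 2) • e4 F ∧
      φ (e5 F) = e5 F - (a * b) • e6 F ∧
      φ (e6 F) = b • e6 F ∧
      φ (e7 F) = b • e7 F ∧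
      φ (e8 F) = (a * b) • e7 F + e8 F := by
  simp only [← map_kantorComb_eq_iff]
  let E := kantorEquiv F
  have hE (x y) : wmul (E x) (E y) = E (kantorTable x y) := wmul_kantorComb x y
  constructor
  · rintro ⟨hφ, hmul⟩
    obtain ⟨a, b, hb, h⟩ := exists_eq_kantorAut
      (ψ := E.symm.toLinearMap ∘ₗ φ ∘ₗ E.toLinearMap)
      (E.symm.bijective.comp (hφ.comp E.bijective)) fun x y => by
        simp [← E.injective.eq_iff, ← hE, hmul]
    exact ⟨a, b, hb, fun x => E.symm_apply_eq.1 (h x)⟩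
  · rintro ⟨a, b, hb, h⟩
    have h' (x) : φ (E x) = E (kantorAut a b x) := h x
    have hinj : Function.Injective φ := by
      intro A B hAB
      obtain ⟨x, rfl⟩ := E.surjective A
      obtain ⟨y, rfl⟩ := E.surjective B
      rw [h', h'] at hAB
      rw [kantorAut_injective hb (E.injective hAB)]
    have : Module.Finite F (Wtwo F) := Module.Finite.equiv E
    refine ⟨⟨hinj, LinearMap.injective_iff_surjective.1 hinj⟩, ?_⟩
    rw [E.surjective.forall₂]
    intro x y
    rw [hE, h', h', h', hE, kantorAut_kantorTable hb]
end

section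
/- Every local derivation of the algebra W(2) is a derivation. -/
set_option maxSynthPendingDepth 3

variable {F : Type*} [Field F]

/-- The multiplication sending `(vᵢ, vⱼ)` to `vₖ` and every other pair of basis vectors to `0`. -/
noncomputable def basisMul (i j k : Fin 2) : Wtwo F :=
  LinearMap.mk₂ F (fun x y => Pi.single k (x i * y j))
    (fun x x' y => by simp [add_mul, Pi.single_add])
    (fun c x y => by simp [mul_assoc, ← Pi.single_smul])
    (fun x y y' => by simp [mul_add, Pi.single_add])
    (fun c x y => by simp [mul_left_comm, ← Pi.single_smul])

/-- The structure constants of a multiplication on `V₂`. -/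
noncomputable def coord (A : Wtwo F) (s t u : Fin 2) : F := A (Pi.single s 1) (Pi.single t 1) u

theorem ext_coord {A B : Wtwo F} (h : ∀ s t u, coord A s t u = coord B s t u) : A = B := by
  refine LinearMap.pi_ext' fun s => LinearMap.ext_ring (LinearMap.pi_ext' fun t =>
    LinearMap.ext_ring (funext fun u => ?_))
  simpa [coord] using h s t u

@[simp] theorem coord_add (A B : Wtwo F) (s t u : Fin 2) :
    coord (A + B) s t u = coord A s t u + coord B s t u := rfl

@[simp] theorem coord_sub (A B : Wtwo F) (s t u : Fin 2) :
    coord (A - B) s t u = coord A s t u - coord B s t u := rfl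

@[simp] theorem coord_smul (c : F) (A : Wtwo F) (s t u : Fin 2) :
    coord (c • A) s t u = c * coord A s t u := rfl

@[simp] theorem coord_zero (s t u : Fin 2) : coord (0 : Wtwo F) s t u = 0 := rfl

theorem coord_ite (c : Prop) [Decidable c] (A B : Wtwo F) (s t u : Fin 2) :
    coord (if c then A else B) s t u = if c then coord A s t u else coord B s t u := by
  split_ifs <;> rfl

theorem coord_basisMul (i j k s t u : Fin 2) :
    coord (basisMul i j k : Wtwo F) s t u = if i = s ∧ j = t ∧ k = u then 1 else 0 := by
  simp only [coord, basisMul, LinearMap.mk₂_apply, Pi.single_apply]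
  grind

theorem eq_sum_basisMul (A : Wtwo F) :
    A = ∑ i, ∑ j, ∑ k, coord A i j k • basisMul i j k := by
  refine ext_coord fun s t u => ?_
  simp only [Fin.sum_univ_two, coord_add, coord_smul, coord_basisMul]
  fin_cases s <;> fin_cases t <;> fin_cases u <;> simp

theorem coord_apply_left (A : Wtwo F) (x : V2 F) (t u : Fin 2) :
    A x (Pi.single t 1) u = ∑ m, x m * coord A m t u := by
  conv_lhs => rw [pi_eq_sum_univ' x]
  simp [coord]

theorem coord_apply_right (A : Wtwo F) (s : Fin 2) (y : V2 F) (u : Fin 2) :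
    A (Pi.single s 1) y u = ∑ m, y m * coord A s m u := by
  conv_lhs => rw [pi_eq_sum_univ' y]
  simp [coord]

theorem coord_wmul (A B : Wtwo F) (s t u : Fin 2) :
    coord (wmul A B) s t u = ∑ m, (coord A 0 m u * coord B s t m
      - coord A 0 s m * coord B m t u - coord A 0 t m * coord B s m u) := by
  have h : coord (wmul A B) s t u = A (Pi.single 0 1) (B (Pi.single s 1) (Pi.single t 1)) u
      - B (A (Pi.single 0 1) (Pi.single s 1)) (Pi.single t 1) u
      - B (Pi.single s 1) (A (Pi.single 0 1) (Pi.single t 1)) u := rfl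
  rw [h, coord_apply_right, coord_apply_left, coord_apply_right]
  simp only [Fin.sum_univ_two, coord]
  ring

theorem wmul_basisMul (i j k p q r : Fin 2) :
    wmul (basisMul i j k) (basisMul p q r : Wtwo F) = if i = 0 then
      (if r = j then basisMul p q k else 0) - (if p = k then basisMul j q r else 0)
        - (if q = k then basisMul p j r else 0) else 0 := by
  refine ext_coord fun s t u => ?_
  simp only [coord_wmul, coord_basisMul, coord_ite, coord_sub, coord_zero, ite_and, ite_mul, one_mul,
    zero_mul, Finset.sum_sub_distrib, Finset.sum_ite_irrel, Finset.sum_ite_eq,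
    Finset.sum_const_zero, Finset.mem_univ, if_true]
  by_cases hi : i = 0
  · subst hi
    simp only [if_true]
    grind
  · simp [hi]

/-- The Leibniz rule on pairs of basis multiplications, in coordinates. -/
theorem IsDerivation.coord_basisMul {D : Wtwo F →ₗ[F] Wtwo F} (hD : IsDerivation D)
    {d : Fin 2 → Fin 2 → Fin 2 → Fin 2 → Fin 2 → Fin 2 → F}
    (hd : ∀ i j k s t u, d i j k s t u = coord (D (basisMul i j k)) s t u)
    (i j k p q r s t u : Fin 2) :
    (if i = 0 then (if r = j then d p q k s t u else 0) - (if p = k then d j q r s t u else 0)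
        - (if q = k then d p j r s t u else 0) else 0) =
      (if p = s ∧ q = t then d i j k 0 r u else 0) - (if q = t ∧ r = u then d i j k 0 s p else 0)
        - (if p = s ∧ r = u then d i j k 0 t q else 0)
        + if i = 0 then (if k = u then d p q r s t j else 0) - (if j = s then d p q r k t u else 0)
          - (if j = t then d p q r s k u else 0) else 0 := by
  have h := congrArg (fun A => coord A s t u) (hD (basisMul i j k) (basisMul p q r))
  simp only [wmul_basisMul, coord_add, coord_wmul, _root_.coord_basisMul] at h
  simp only [apply_ite D, coord_ite, map_sub, map_zero, coord_sub, coord_zero, ← hd] at h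
  simp only [ite_and, ite_mul, mul_ite, mul_one, one_mul, zero_mul, mul_zero,
    Finset.sum_sub_distrib, Finset.sum_ite_irrel, Finset.sum_ite_eq,
    Finset.sum_const_zero, Finset.mem_univ, if_true] at h ⊢
  rw [h]
  by_cases hi : i = 0 <;> simp [hi]

/-- The action of `φ : V₂ → V₂` on multiplications as an infinitesimal change of coordinates. -/
noncomputable def endAction (φ : V2 F →ₗ[F] V2 F) : Wtwo F →ₗ[F] Wtwo F where
  toFun A := A.compr₂ φ - A.comp φ - A.compl₂ φ
  map_add' A B := by ext; simp; ring
  map_smul' c A := by ext; simp; ring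

theorem endAction_apply (φ : V2 F →ₗ[F] V2 F) (A : Wtwo F) (x y : V2 F) :
    endAction φ A x y = φ (A x y) - A (φ x) y - A x (φ y) := rfl

theorem isDerivation_endAction {φ : V2 F →ₗ[F] V2 F} (hφ : φ (v1 F) = 0) :
    IsDerivation (endAction φ) := by
  intro A B
  refine LinearMap.ext₂ fun x y => ?_
  simp only [endAction_apply, LinearMap.add_apply, wmul, LinearMap.mk₂_apply, map_sub, hφ,
    map_zero, LinearMap.zero_apply, LinearMap.sub_apply]
  abel

/-- The derivation of `W(2)` induced by the endomorphism `v₁ ↦ 0`, `v₂ ↦ w` of `V₂`. -/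
noncomputable def shearDerivation (w : V2 F) : Wtwo F →ₗ[F] Wtwo F :=
  endAction ((LinearMap.proj 1).smulRight w)

theorem isDerivation_shearDerivation (w : V2 F) : IsDerivation (shearDerivation w) :=
  isDerivation_endAction (by simp [v1])

theorem coord_shearDerivation (w : V2 F) (A : Wtwo F) (s t u : Fin 2) :
    coord (shearDerivation w A) s t u = coord A s t 1 * w u
      - (if s = 1 then ∑ m, w m * coord A m t u else 0)
      - (if t = 1 then ∑ m, w m * coord A s m u else 0) := by
  have h : coord (shearDerivation w A) s t u = coord A s t 1 * w u
      - A ((Pi.single s 1 : V2 F) 1 • w) (Pi.single t 1) u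
      - A (Pi.single s 1) ((Pi.single t 1 : V2 F) 1 • w) u := rfl
  rw [h, coord_apply_left, coord_apply_right]
  fin_cases s <;> fin_cases t <;> simp

/-- The Leibniz rule in coordinates determines all coordinates of a derivation from the two
coordinates `d 0 0 1 0 0 u`. -/
theorem derivation_coord_eq [CharZero F]
    {d : Fin 2 → Fin 2 → Fin 2 → Fin 2 → Fin 2 → Fin 2 → F}
    (H : ∀ i j k p q r s t u : Fin 2,
      (if i = 0 then (if r = j then d p q k s t u else 0) - (if p = k then d j q r s t u else 0)
          - (if q = k then d p j r s t u else 0) else 0) =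
        (if p = s ∧ q = t then d i j k 0 r u else 0)
          - (if q = t ∧ r = u then d i j k 0 s p else 0)
          - (if p = s ∧ r = u then d i j k 0 t q else 0)
          + if i = 0 then (if k = u then d p q r s t j else 0)
            - (if j = s then d p q r k t u else 0) - (if j = t then d p q r s k u else 0) else 0)
    (i j k s t u : Fin 2) :
    d i j k s t u = (if i = s ∧ j = t ∧ k = 1 then 1 else 0) * d 0 0 1 0 0 u
      - (if s = 1 then d 0 0 1 0 0 0 * (if i = 0 ∧ j = t ∧ k = u then 1 else 0)
          + d 0 0 1 0 0 1 * (if i = 1 ∧ j = t ∧ k = u then 1 else 0) else 0)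
      - (if t = 1 then d 0 0 1 0 0 0 * (if i = s ∧ j = 0 ∧ k = u then 1 else 0)
          + d 0 0 1 0 0 1 * (if i = s ∧ j = 1 ∧ k = u then 1 else 0) else 0) := by
  have h000000 : d 0 0 0 0 0 0 = 0 := by
    have := H 0 0 0 0 0 0 0 0 0; grind
  have h000110 : d 0 0 0 1 1 0 = 0 := by
    have := H 0 0 0 0 0 0 1 1 0; grind
  have h000111 : d 0 0 0 1 1 1 = 0 := by
    have := H 0 0 0 0 0 0 1 1 1; grind
  have h000010 : d 0 0 0 0 1 0 = -d 0 0 1 0 0 0 := by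
    have := H 0 0 0 0 0 1 0 0 0; grind
  have h000011 : d 0 0 0 0 1 1 = 0 := by
    have := H 0 0 0 0 0 1 0 0 1; grind
  have h001010 : d 0 0 1 0 1 0 = 0 := by
    have := H 0 0 0 0 0 1 0 1 0; grind
  have h001011 : d 0 0 1 0 1 1 = -d 0 0 1 0 0 0 := by
    have := H 0 0 0 0 0 1 0 1 1; grind
  have h001100 : d 0 0 1 1 0 0 = 0 := by
    have := H 0 0 0 0 0 1 1 0 0; grind
  have h001101 : d 0 0 1 1 0 1 = -d 0 0 1 0 0 0 := by
    have := H 0 0 0 0 0 1 1 0 1; grind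
  have h001110 : d 0 0 1 1 1 0 = 0 := by
    have := H 0 0 0 0 0 1 1 1 0; grind
  have h001111 : d 0 0 1 1 1 1 = 0 := by
    have := H 0 0 0 0 0 1 1 1 1; grind
  have h010001 : d 0 1 0 0 0 1 = 0 := by
    have := H 0 0 0 0 1 0 0 0 1; grind
  have h010101 : d 0 1 0 1 0 1 = 0 := by
    have := H 0 0 0 0 1 0 1 0 1; grind
  have h010110 : d 0 1 0 1 1 0 = -d 0 0 1 0 0 0 := by
    have := H 0 0 0 0 1 0 1 1 0; grind
  have h011010 : d 0 1 1 0 1 0 = d 0 0 1 0 0 0 := by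
    have := H 0 0 0 0 1 1 0 1 0; grind
  have h011100 : d 0 1 1 1 0 0 = 0 := by
    have := H 0 0 0 0 1 1 1 0 0; grind
  have h011110 : d 0 1 1 1 1 0 = 0 := by
    have := H 0 0 0 0 1 1 1 1 0; grind
  have h011111 : d 0 1 1 1 1 1 = -d 0 0 1 0 0 0 := by
    have := H 0 0 0 0 1 1 1 1 1; grind
  have h100001 : d 1 0 0 0 0 1 = 0 := by
    have := H 0 0 0 1 0 0 0 0 1; grind
  have h100011 : d 1 0 0 0 1 1 = 0 := by
    have := H 0 0 0 1 0 0 0 1 1; grind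
  have h100110 : d 1 0 0 1 1 0 = -d 0 0 1 0 0 0 := by
    have := H 0 0 0 1 0 0 1 1 0; grind
  have h101010 : d 1 0 1 0 1 0 = 0 := by
    have := H 0 0 0 1 0 1 0 1 0; grind
  have h101100 : d 1 0 1 1 0 0 = d 0 0 1 0 0 0 := by
    have := H 0 0 0 1 0 1 1 0 0; grind
  have h101110 : d 1 0 1 1 1 0 = 0 := by
    have := H 0 0 0 1 0 1 1 1 0; grind
  have h101111 : d 1 0 1 1 1 1 = -d 0 0 1 0 0 0 := by
    have := H 0 0 0 1 0 1 1 1 1; grind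
  have h110000 : d 1 1 0 0 0 0 = 0 := by
    have := H 0 0 0 1 1 0 0 0 0; grind
  have h110001 : d 1 1 0 0 0 1 = 0 := by
    have := H 0 0 0 1 1 0 0 0 1; grind
  have h110011 : d 1 1 0 0 1 1 = 0 := by
    have := H 0 0 0 1 1 0 0 1 1; grind
  have h110101 : d 1 1 0 1 0 1 = 0 := by
    have := H 0 0 0 1 1 0 1 0 1; grind
  have h111000 : d 1 1 1 0 0 0 = 0 := by
    have := H 0 0 0 1 1 1 0 0 0; grind
  have h111001 : d 1 1 1 0 0 1 = 0 := by
    have := H 0 0 0 1 1 1 0 0 1; grind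
  have h111110 : d 1 1 1 1 1 0 = d 0 0 1 0 0 0 := by
    have := H 0 0 0 1 1 1 1 1 0; grind
  have h000100 : d 0 0 0 1 0 0 = -d 0 0 1 0 0 0 := by
    have := H 0 0 1 0 0 0 0 0 0; grind
  have h000101 : d 0 0 0 1 0 1 = 0 := by
    have := H 0 0 1 0 0 0 0 0 1; grind
  have h100010 : d 1 0 0 0 1 0 = 0 := by
    have := H 0 1 0 0 0 0 0 1 0; grind
  have h011000 : d 0 1 1 0 0 0 = 0 := by
    have := H 0 1 1 0 0 0 0 0 0; grind
  have h011011 : d 0 1 1 0 1 1 = 0 := by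
    have := H 0 1 1 0 0 1 0 0 1; grind
  have h100000 : d 1 0 0 0 0 0 = 0 := by
    have := H 1 0 0 0 0 0 0 0 0; grind
  have h101000 : d 1 0 1 0 0 0 = 0 := by
    have := H 1 0 1 0 0 0 0 0 0; grind
  have h101001 : d 1 0 1 0 0 1 = 0 := by
    have := H 1 0 1 0 0 0 0 0 1; grind
  have h101011 : d 1 0 1 0 1 1 = 0 := by
    have := H 1 0 1 0 0 1 0 0 1; grind
  have h110010 : d 1 1 0 0 1 0 = 0 := by
    have := H 1 1 0 0 0 0 0 1 0; grind
  have h111010 : d 1 1 1 0 1 0 = 0 := by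
    have := H 1 1 1 0 0 0 0 1 0; grind
  have h111011 : d 1 1 1 0 1 1 = 0 := by
    have := H 1 1 1 0 0 1 0 0 1; grind
  have h000001 : d 0 0 0 0 0 1 = 0 := by
    have := H 0 0 0 1 0 0 0 0 0; grind
  have h100101 : d 1 0 0 1 0 1 = 0 := by
    have := H 0 0 0 1 0 0 1 0 1; grind
  have h110100 : d 1 1 0 1 0 0 = 0 := by
    have := H 0 0 0 1 1 0 1 0 0; grind
  have h110111 : d 1 1 0 1 1 1 = 0 := by
    have := H 0 0 0 1 1 0 1 1 1; grind
  have h111101 : d 1 1 1 1 0 1 = 0 := by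
    have := H 0 0 0 1 1 1 1 0 1; grind
  have h011101 : d 0 1 1 1 0 1 = 0 := by
    have := H 0 0 1 0 1 1 0 0 1; grind
  have h100100 : d 1 0 0 1 0 0 = -d 0 0 1 0 0 1 := by
    have := H 0 0 1 1 0 0 0 0 0; grind
  have h100111 : d 1 0 0 1 1 1 = 0 := by
    have := H 0 0 1 1 0 0 0 1 1; grind
  have h101101 : d 1 0 1 1 0 1 = 0 := by
    have := H 0 0 1 1 0 0 1 0 1; grind
  have h010000 : d 0 1 0 0 0 0 = 0 := by
    have := H 0 0 1 1 1 0 0 0 0; grind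
  have h010011 : d 0 1 0 0 1 1 = 0 := by
    have := H 0 0 1 1 1 0 0 1 1; grind
  have h111100 : d 1 1 1 1 0 0 = 0 := by
    have := H 0 0 1 1 1 1 0 0 0; grind
  have h011001 : d 0 1 1 0 0 1 = 0 := by
    have := H 0 0 1 1 1 1 0 0 1; grind
  have h111111 : d 1 1 1 1 1 1 = -d 0 0 1 0 0 1 := by
    have := H 0 0 1 1 1 1 0 1 1; grind
  have h010111 : d 0 1 0 1 1 1 = 0 := by
    have := H 0 1 0 0 0 0 1 1 1; grind
  have h010010 : d 0 1 0 0 1 0 = -d 0 0 1 0 0 1 := by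
    have := H 0 1 0 0 0 1 0 0 0; grind
  have h010100 : d 0 1 0 1 0 0 = 0 := by
    have := H 0 1 0 0 1 1 1 0 0; grind
  have h110110 : d 1 1 0 1 1 0 = -2 * d 0 0 1 0 0 1 := by
    have := H 0 1 0 1 0 0 1 1 0; grind
  fin_cases i <;> fin_cases j <;> fin_cases k <;> fin_cases s <;> fin_cases t <;> fin_cases u <;>
    simp [*]
  ring

theorem IsDerivation.exists_eq_shearDerivation [CharZero F] {D : Wtwo F →ₗ[F] Wtwo F}
    (hD : IsDerivation D) : ∃ w : V2 F, D = shearDerivation w := by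
  obtain ⟨w, h⟩ : ∃ w : V2 F, ∀ i j k,
      D (basisMul i j k) = shearDerivation w (basisMul i j k) := by
    refine ⟨fun u => coord (D (basisMul 0 0 1)) 0 0 u, fun i j k => ext_coord fun s t u => ?_⟩
    rw [coord_shearDerivation]
    simp only [_root_.coord_basisMul, Fin.sum_univ_two]
    exact derivation_coord_eq (hD.coord_basisMul fun _ _ _ _ _ _ => rfl) i j k s t u
  refine ⟨w, LinearMap.ext fun A => ?_⟩
  rw [eq_sum_basisMul A]
  simp only [map_sum, map_smul, h]

/-- Every local derivation of the algebra `W(2)` is a derivation. -/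
theorem every_localDerivation_isDerivation {F : Type*} [Field F] [CharZero F]
    (T : Wtwo F →ₗ[F] Wtwo F)
    (hT : ∀ x : Wtwo F, ∃ D : Wtwo F →ₗ[F] Wtwo F, IsDerivation D ∧ T x = D x) :
    IsDerivation T := by
  have hT' (x : Wtwo F) : ∃ w : V2 F, T x = shearDerivation w x := by
    obtain ⟨D, hD, hx⟩ := hT x
    obtain ⟨w, rfl⟩ := hD.exists_eq_shearDerivation
    exact ⟨w, hx⟩
  obtain ⟨w, hw⟩ := hT' (basisMul 0 0 1)
  have hker (x : Wtwo F) (hx : coord x 0 0 1 = 0) : T x = shearDerivation w x := by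
    obtain ⟨w', hw'⟩ := hT' (x + basisMul 0 0 1)
    obtain ⟨w'', hw''⟩ := hT' x
    have : w = w' := by
      funext u
      have h := congrArg (fun A => coord A 0 0 u) hw'
      rw [map_add, hw, hw''] at h
      simpa [coord_shearDerivation, coord_basisMul, hx] using h
    rw [← this, map_add, map_add, hw] at hw'
    exact add_right_cancel hw'
  suffices T = shearDerivation w from this ▸ isDerivation_shearDerivation w
  refine LinearMap.ext fun x => ?_
  rw [← sub_add_cancel x (coord x 0 0 1 • basisMul 0 0 1), map_add, map_add, map_smul, map_smul,
    hw, hker]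
  simp [coord_basisMul]
end

section
/- Every 2-local derivation of the algebra W(2) is a derivation (in particular, it is linear). -/
set_option maxSynthPendingDepth 3

variable {F : Type*} [Field F]

/-- The multiplication on `V₂` with structure constants `v₁v₁ = a v₁ + b v₂`,
`v₁v₂ = c v₁ + d v₂`, `v₂v₁ = e v₁ + f v₂`, `v₂v₂ = g v₁ + h v₂`. -/
noncomputable def ofCoeffs (a b c d e f g h : F) : Wtwo F :=
  LinearMap.mk₂ F
    (fun x y => ![a * (x 0 * y 0) + c * (x 0 * y 1) + e * (x 1 * y 0) + g * (x 1 * y 1),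
      b * (x 0 * y 0) + d * (x 0 * y 1) + f * (x 1 * y 0) + h * (x 1 * y 1)])
    (fun x x' y => by ext k; fin_cases k <;> simp <;> ring)
    (fun r x y => by ext k; fin_cases k <;> simp <;> ring)
    (fun x y y' => by ext k; fin_cases k <;> simp <;> ring)
    (fun r x y => by ext k; fin_cases k <;> simp <;> ring)

theorem ofCoeffs_apply (a b c d e f g h : F) (x y : V2 F) :
    ofCoeffs a b c d e f g h x y =
      ![a * (x 0 * y 0) + c * (x 0 * y 1) + e * (x 1 * y 0) + g * (x 1 * y 1),
        b * (x 0 * y 0) + d * (x 0 * y 1) + f * (x 1 * y 0) + h * (x 1 * y 1)] :=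
  rfl

theorem exists_eq_ofCoeffs (z : Wtwo F) :
    ∃ a b c d e f g h : F, z = ofCoeffs a b c d e f g h := by
  refine ⟨z (Pi.single 0 1) (Pi.single 0 1) 0, z (Pi.single 0 1) (Pi.single 0 1) 1,
    z (Pi.single 0 1) (Pi.single 1 1) 0, z (Pi.single 0 1) (Pi.single 1 1) 1,
    z (Pi.single 1 1) (Pi.single 0 1) 0, z (Pi.single 1 1) (Pi.single 0 1) 1,
    z (Pi.single 1 1) (Pi.single 1 1) 0, z (Pi.single 1 1) (Pi.single 1 1) 1, ?_⟩
  ext i j k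
  fin_cases i <;> fin_cases j <;> fin_cases k <;> simp [ofCoeffs_apply]

theorem ofCoeffs_add (a b c d e f g h a' b' c' d' e' f' g' h' : F) :
    ofCoeffs a b c d e f g h + ofCoeffs a' b' c' d' e' f' g' h' =
      ofCoeffs (a + a') (b + b') (c + c') (d + d') (e + e') (f + f') (g + g') (h + h') := by
  ext i j k
  fin_cases i <;> fin_cases j <;> fin_cases k <;> simp [ofCoeffs_apply]

theorem smul_ofCoeffs (r a b c d e f g h : F) :
    r • ofCoeffs a b c d e f g h =
      ofCoeffs (r * a) (r * b) (r * c) (r * d) (r * e) (r * f) (r * g) (r * h) := by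
  ext i j k
  fin_cases i <;> fin_cases j <;> fin_cases k <;> simp [ofCoeffs_apply]

theorem wmul_ofCoeffs (a b c d e f g h a' b' c' d' e' f' g' h' : F) :
    wmul (ofCoeffs a b c d e f g h) (ofCoeffs a' b' c' d' e' f' g' h') =
      ofCoeffs
        (a * a' + c * b' - a * a' - a * a' - b * e' - b * c')
        (b * a' + d * b' - a * b' - a * b' - b * f' - b * d')
        (a * c' + c * d' - a * c' - c * a' - b * g' - d * c')
        (b * c' + d * d' - a * d' - c * b' - b * h' - d * d')
        (a * e' + c * f' - c * a' - a * e' - d * e' - b * g')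
        (b * e' + d * f' - c * b' - a * f' - d * f' - b * h')
        (a * g' + c * h' - c * c' - c * e' - d * g' - d * g')
        (b * g' + d * h' - c * d' - c * f' - d * h' - d * h') := by
  ext i j k
  fin_cases i <;> fin_cases j <;> fin_cases k <;>
    simp [wmul, v1, ofCoeffs_apply] <;> ring

theorem IsDerivation.map_wmul_eq_zero {D : Wtwo F →ₗ[F] Wtwo F} (hD : IsDerivation D)
    {x y : Wtwo F} (hx : D x = 0) (hy : D y = 0) : D (wmul x y) = 0 := by
  rw [hD, hx, hy]
  ext
  simp [wmul]

theorem IsDerivation.sub {D E : Wtwo F →ₗ[F] Wtwo F} (hD : IsDerivation D)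
    (hE : IsDerivation E) : IsDerivation (D - E) := by
  intro x y
  simp only [LinearMap.sub_apply, hD x y, hE x y]
  ext
  simp [wmul]
  ring

/-- The algebra `W(2)` is generated by a single element, so a derivation killing it vanishes. -/
theorem IsDerivation.eq_zero_of_map_generator_eq_zero [CharZero F]
    {D : Wtwo F →ₗ[F] Wtwo F} (hD : IsDerivation D)
    (h₀ : D (ofCoeffs 0 1 0 0 0 1 1 1) = 0) : D = 0 := by
  have h₁ : D (ofCoeffs 0 (-1) (-1) (-1) (-1) (-1) 0 1) = 0 := by
    convert hD.map_wmul_eq_zero h₀ h₀ using 2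
    rw [wmul_ofCoeffs]
    congr 1 <;> norm_num
  have h₂ : D (ofCoeffs 2 2 0 (-2) 0 (-2) 0 0) = 0 := by
    convert hD.map_wmul_eq_zero h₀ h₁ using 2
    rw [wmul_ofCoeffs]
    congr 1 <;> norm_num
  have h₃ : D (ofCoeffs (-1) 0 1 2 0 2 1 1) = 0 := by
    convert hD.map_wmul_eq_zero h₁ h₀ using 2
    rw [wmul_ofCoeffs]
    congr 1 <;> norm_num
  have h₄ : D (ofCoeffs (-1) (-1) 0 1 0 1 (-3) (-1)) = 0 := by
    convert hD.map_wmul_eq_zero h₁ h₁ using 2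
    rw [wmul_ofCoeffs]
    congr 1 <;> norm_num
  have h₅ : D (ofCoeffs (-2) (-8) 4 2 4 2 0 (-4)) = 0 := by
    convert hD.map_wmul_eq_zero h₁ h₂ using 2
    rw [wmul_ofCoeffs]
    congr 1 <;> norm_num
  have h₆ : D (ofCoeffs 0 6 0 0 0 0 0 0) = 0 := by
    convert hD.map_wmul_eq_zero h₀ h₂ using 2
    rw [wmul_ofCoeffs]
    congr 1 <;> norm_num
  have h₇ : D (ofCoeffs (-1) (-5) (-1) 0 (-1) (-1) 0 1) = 0 := by
    convert hD.map_wmul_eq_zero h₀ h₃ using 2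
    rw [wmul_ofCoeffs]
    congr 1 <;> norm_num
  ext1 z
  obtain ⟨a, b, c, d, e, f, g, h, rfl⟩ := exists_eq_ofCoeffs z
  have key : ofCoeffs a b c d e f g h =
      (-c + 5 * e / 2 - g / 2 + 3 * h / 2) •
        ofCoeffs 0 1 0 0 0 1 1 1 +
      (-a + 2 * c - 2 * d - 7 * e / 2 + f + g / 2 - 3 * h / 2) •
        ofCoeffs 0 (-1) (-1) (-1) (-1) (-1) 0 1 +
      (a / 4 + c / 4 + d / 4 + e - f / 2 - g / 2 + h) •
        ofCoeffs 2 2 0 (-2) 0 (-2) 0 0 +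
      (c - e) •
        ofCoeffs (-1) 0 1 2 0 2 1 1 +
      (e / 2 - g / 2 + h / 2) •
        ofCoeffs (-1) (-1) 0 1 0 1 (-3) (-1) +
      (-a / 4 + c / 4 - d / 4) •
        ofCoeffs (-2) (-8) 4 2 4 2 0 (-4) +
      (-7 * a / 12 + b / 6 - c / 12 + d / 12 + 5 * e / 6 - f / 2 - g / 6 + h / 2) •
        ofCoeffs 0 6 0 0 0 0 0 0 +
      (-c + d + 5 * e / 2 - f - g / 2 + 3 * h / 2) •
        ofCoeffs (-1) (-5) (-1) 0 (-1) (-1) 0 1 := by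
    simp only [smul_ofCoeffs, ofCoeffs_add]
    congr 1 <;> ring
  rw [key]
  simp only [map_add, map_smul, h₀, h₁, h₂, h₃, h₄, h₅, h₆, h₇, smul_zero, add_zero,
    LinearMap.zero_apply]

/-- Every 2-local derivation of the algebra `W(2)` is a derivation
(in particular, it is linear). -/
theorem every_twoLocalDerivation_isDerivation {F : Type*} [Field F] [CharZero F]
    (Δ : Wtwo F → Wtwo F)
    (hΔ : ∀ x y : Wtwo F, ∃ D : Wtwo F →ₗ[F] Wtwo F,
      IsDerivation D ∧ Δ x = D x ∧ Δ y = D y) :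
    ∃ D : Wtwo F →ₗ[F] Wtwo F, IsDerivation D ∧ ∀ z : Wtwo F, Δ z = D z := by
  obtain ⟨D, hD, hw, -⟩ := hΔ (ofCoeffs 0 1 0 0 0 1 1 1) 0
  refine ⟨D, hD, fun z => ?_⟩
  obtain ⟨E, hE, hEw, hEz⟩ := hΔ (ofCoeffs 0 1 0 0 0 1 1 1) z
  have hDE : D - E = 0 := (hD.sub hE).eq_zero_of_map_generator_eq_zero <| by
    rw [LinearMap.sub_apply, ← hw, ← hEw, sub_self]
  rw [hEz, sub_eq_zero.mp hDE]
end

section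
/- Every 2-local automorphism of the algebra W(2) is an automorphism (in particular, it is linear and bijective). -/
set_option maxSynthPendingDepth 3

variable {F : Type*} [Field F]

/-- The multiplication on `V₂` with structure constants `c`, so that `vᵢ vⱼ = ∑ₖ c i j k vₖ`. -/
noncomputable def Wtwo.ofConsts (c : Fin 2 → Fin 2 → Fin 2 → F) : Wtwo F :=
  LinearMap.mk₂ F (fun x y k => ∑ i, ∑ j, c i j k * x i * y j)
    (fun x x' y => by ext k; simp [Fin.sum_univ_two]; ring)
    (fun r x y => by ext k; simp [Fin.sum_univ_two]; ring)
    (fun x y y' => by ext k; simp [Fin.sum_univ_two]; ring)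
    (fun r x y => by ext k; simp [Fin.sum_univ_two]; ring)

/-- The Kantor product in terms of structure constants. -/
def kantorConsts (a b : Fin 2 → Fin 2 → Fin 2 → F) (i j k : Fin 2) : F :=
  ∑ l, (a 0 l k * b i j l - a 0 i l * b l j k - a 0 j l * b i l k)

theorem Wtwo.ofConsts_apply (c : Fin 2 → Fin 2 → Fin 2 → F) (x y : V2 F) (k : Fin 2) :
    Wtwo.ofConsts c x y k = ∑ i, ∑ j, c i j k * x i * y j := rfl

theorem wmul_apply (A B : Wtwo F) (x y : V2 F) :
    wmul A B x y = A (v1 F) (B x y) - B (A (v1 F) x) y - B x (A (v1 F) y) := rfl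

theorem wmul_ofConsts (a b : Fin 2 → Fin 2 → Fin 2 → F) :
    wmul (Wtwo.ofConsts a) (Wtwo.ofConsts b) = Wtwo.ofConsts (kantorConsts a b) := by
  refine LinearMap.ext fun x => LinearMap.ext fun y => funext fun k => ?_
  simp only [wmul_apply, Pi.sub_apply, Wtwo.ofConsts_apply, kantorConsts, Fin.sum_univ_two, v1,
    Pi.single_eq_same, Pi.single_eq_of_ne (one_ne_zero : (1 : Fin 2) ≠ 0)]
  ring

theorem Wtwo.exists_eq_ofConsts (z : Wtwo F) : ∃ c, z = Wtwo.ofConsts c := by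
  refine ⟨fun i j k => z (Pi.single i 1) (Pi.single j 1) k, ?_⟩
  refine LinearMap.ext fun x => LinearMap.ext fun y => funext fun k => ?_
  rw [Wtwo.ofConsts_apply]
  have basis (v : V2 F) : v = v 0 • Pi.single 0 1 + v 1 • Pi.single 1 1 := by
    ext i; fin_cases i <;> simp
  nth_rewrite 1 [basis x, basis y]
  simp only [map_add, map_smul, LinearMap.add_apply, LinearMap.smul_apply, Pi.add_apply,
    Pi.smul_apply, smul_eq_mul, Fin.sum_univ_two]
  ring

/-- An element generating `W(2)` as an algebra. -/
noncomputable def Wtwo.generator (F : Type*) [Field F] : Wtwo F :=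
  Wtwo.ofConsts ![![![0, 1], ![0, 0]], ![![-1, 1], ![-1, 0]]]

/-- The element `Wtwo.generator F` generates `W(2)` as an algebra; hence a multiplicative linear
map fixing it is the identity. -/
theorem map_eq_self_of_map_generator [CharZero F] (f : Wtwo F →ₗ[F] Wtwo F)
    (hf : ∀ x y, f (wmul x y) = wmul (f x) (f y))
    (h₀ : f (Wtwo.generator F) = Wtwo.generator F) (z : Wtwo F) :
    f z = z := by
  rw [Wtwo.generator] at h₀
  have mul_mem (a b c : Fin 2 → Fin 2 → Fin 2 → F)
      (ha : f (Wtwo.ofConsts a) = Wtwo.ofConsts a) (hb : f (Wtwo.ofConsts b) = Wtwo.ofConsts b)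
      (hc : ∀ i j k, c i j k = kantorConsts a b i j k) :
      f (Wtwo.ofConsts c) = Wtwo.ofConsts c := by
    obtain rfl : c = kantorConsts a b := by ext i j k; exact hc i j k
    rw [← wmul_ofConsts, hf, ha, hb]
  have h₁ := mul_mem _ _ ![![![1, -1], ![1, 0]], ![![1, -1], ![0, -1]]] h₀ h₀
    (by norm_num [Fin.forall_fin_two, kantorConsts, Fin.sum_univ_two])
  have h₂ := mul_mem _ _ ![![![-2, 2], ![0, 2]], ![![0, 2], ![0, 0]]] h₀ h₁
    (by norm_num [Fin.forall_fin_two, kantorConsts, Fin.sum_univ_two])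
  have h₃ := mul_mem _ _ ![![![0, -1], ![-1, -1]], ![![0, -1], ![0, 0]]] h₁ h₀
    (by norm_num [Fin.forall_fin_two, kantorConsts, Fin.sum_univ_two])
  have h₄ := mul_mem _ _ ![![![0, -6], ![0, 0]], ![![0, 0], ![0, 0]]] h₀ h₂
    (by norm_num [Fin.forall_fin_two, kantorConsts, Fin.sum_univ_two])
  have h₅ := mul_mem _ _ ![![![0, 0], ![-1, -1]], ![![-2, 0], ![-3, 1]]] h₁ h₁
    (by norm_num [Fin.forall_fin_two, kantorConsts, Fin.sum_univ_two])
  have h₆ := mul_mem _ _ ![![![2, 4], ![2, 0]], ![![4, 0], ![6, -2]]] h₂ h₀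
    (by norm_num [Fin.forall_fin_two, kantorConsts, Fin.sum_univ_two])
  have h₇ := mul_mem _ _ ![![![4, 2], ![4, -4]], ![![4, -4], ![0, -4]]] h₁ h₂
    (by norm_num [Fin.forall_fin_two, kantorConsts, Fin.sum_univ_two])
  obtain ⟨c, rfl⟩ := z.exists_eq_ofConsts
  have expand : (12 : F) • Wtwo.ofConsts c =
      (-18 * c 1 0 0 + 6 * c 1 1 0 - 18 * c 1 1 1) •
        Wtwo.ofConsts ![![![0, 1], ![0, 0]], ![![-1, 1], ![-1, 0]]] +
      (12 * c 0 0 0 - 12 * c 0 1 0 + 12 * c 0 1 1 + 6 * c 1 0 0 - 6 * c 1 1 0 - 6 * c 1 1 1) •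
        Wtwo.ofConsts ![![![1, -1], ![1, 0]], ![![1, -1], ![0, -1]]] +
      (-6 * c 0 1 0 + 12 * c 1 0 0 + 6 * c 1 0 1 - 6 * c 1 1 0) •
        Wtwo.ofConsts ![![![-2, 2], ![0, 2]], ![![0, 2], ![0, 0]]] +
      (-12 * c 0 1 0 - 12 * c 1 1 1) •
        Wtwo.ofConsts ![![![0, -1], ![-1, -1]], ![![0, -1], ![0, 0]]] +
      (c 0 0 0 - 2 * c 0 0 1 - c 0 1 0 - 3 * c 0 1 1 + 6 * c 1 0 0 + 6 * c 1 0 1 -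
          2 * c 1 1 0 + 2 * c 1 1 1) •
        Wtwo.ofConsts ![![![0, -6], ![0, 0]], ![![0, 0], ![0, 0]]] +
      (12 * c 0 0 0 - 12 * c 0 1 0 + 24 * c 1 0 0 + 12 * c 1 0 1 - 12 * c 1 1 0 + 12 * c 1 1 1) •
        Wtwo.ofConsts ![![![0, 0], ![-1, -1]], ![![-2, 0], ![-3, 1]]] +
      (6 * c 0 0 0 - 6 * c 0 1 0 + 9 * c 1 0 0 + 6 * c 1 0 1 - 3 * c 1 1 0 + 3 * c 1 1 1) •
        Wtwo.ofConsts ![![![2, 4], ![2, 0]], ![![4, 0], ![6, -2]]] +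
      (-3 * c 0 0 0 + 3 * c 0 1 0 - 3 * c 0 1 1) •
        Wtwo.ofConsts ![![![4, 2], ![4, -4]], ![![4, -4], ![0, -4]]] := by
    refine LinearMap.ext fun x => LinearMap.ext fun y => funext fun k => ?_
    fin_cases k <;>
    · simp [Wtwo.ofConsts_apply, Fin.sum_univ_two]
      ring
  have twelve_ne : (12 : F) ≠ 0 := by norm_num
  apply smul_right_injective _ twelve_ne
  simp only
  rw [← map_smul, expand]
  simp only [map_add, map_smul, h₀, h₁, h₂, h₃, h₄, h₅, h₆, h₇]

/-- Every 2-local automorphism of the algebra `W(2)` is an automorphism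
(in particular, it is linear and bijective). -/
theorem every_twoLocalAutomorphism_isAutomorphism {F : Type*} [Field F] [CharZero F]
    (Δ : Wtwo F → Wtwo F)
    (hΔ : ∀ x y : Wtwo F, ∃ φ : Wtwo F →ₗ[F] Wtwo F,
      IsAutomorphism φ ∧ Δ x = φ x ∧ Δ y = φ y) :
    ∃ φ : Wtwo F →ₗ[F] Wtwo F, IsAutomorphism φ ∧ ∀ z : Wtwo F, Δ z = φ z := by
  obtain ⟨φ, hφ, hφ₀, -⟩ := hΔ (Wtwo.generator F) 0
  refine ⟨φ, hφ, fun z => ?_⟩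
  obtain ⟨ψ, hψ, hψ₀, hψz⟩ := hΔ (Wtwo.generator F) z
  let e := LinearEquiv.ofBijective φ hφ.1
  have he (w : Wtwo F) : e w = φ w := rfl
  have he_symm (w : Wtwo F) : φ (e.symm w) = w := e.apply_symm_apply w
  have fixed := map_eq_self_of_map_generator (e.symm.toLinearMap ∘ₗ ψ)
    (fun x y => e.injective (by simp [he, he_symm, hφ.2, hψ.2]))
    (e.injective (by simp [he, he_symm, ← hψ₀, hφ₀])) z
  rw [hψz, ← he, ← e.symm_apply_eq]
  exact fixed
end
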